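/- For every λ > 0, tanh²(√λ)/λ = Σ_{n≥0} ( 2/(a_n(λ + a_n)) + 4/(λ + a_n)² ) where a_n = π²(2n+1)²/4. -/

import Mathlib

open Real

theorem hasSum_coth (x : ℝ) (hx : x ≠ 0) :
    HasSum (fun n : ℕ ↦ 2 * x / (x ^ 2 + π ^ 2 * (n + 1) ^ 2)) (cosh x / sinh x - 1 / x) := by
  have hpi : (π : ℂ) ≠ 0 := by exact_mod_cast pi_ne_zero
  have hxc : (x : ℂ) ≠ 0 := by exact_mod_cast hx
  have hz : (x / π : ℂ) * Complex.I ∈ Complex.integerComplement := by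
    rw [Complex.mem_integerComplement_iff]
    rintro ⟨m, hm⟩
    have := congrArg Complex.im hm
    rw [← Complex.ofReal_div] at this
    simp [hx, pi_ne_zero, eq_comm] at this
  have h := (summable_cotTerm hz).hasSum
  rw [← cot_series_rep' hz] at h
  rw [← Complex.hasSum_ofReal]
  convert! (h.mul_left (Complex.I / π)) using 1
  · ext n
    have hne : (x : ℂ) ^ 2 + π ^ 2 * (n + 1) ^ 2 ≠ 0 := by
      have : 0 < x ^ 2 + π ^ 2 * (n + 1) ^ 2 := by positivity
      exact_mod_cast this.ne'
    rw [cotTerm_identity hz]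
    have e : ((x / π : ℂ) * Complex.I + (n + 1)) * ((x / π : ℂ) * Complex.I - (n + 1)) =
        -((x : ℂ) ^ 2 + π ^ 2 * (n + 1) ^ 2) / π ^ 2 := by
      field_simp
      ring_nf
      simp
    rw [e]
    push_cast
    field_simp
    simp
  · have e : (π : ℂ) * (x / π * Complex.I) = x * Complex.I := by field_simp
    have hs : Complex.sinh (x : ℂ) ≠ 0 := by
      rw [← Complex.ofReal_sinh]; exact_mod_cast Real.sinh_ne_zero.2 hx
    rw [e, Complex.cot, Complex.cos_mul_I, Complex.sin_mul_I]
    push_cast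
    field_simp

theorem hasSum_tanh (x : ℝ) :
    HasSum (fun n : ℕ ↦ 2 * x / (x ^ 2 + π ^ 2 * (2 * n + 1) ^ 2 / 4)) (tanh x) := by
  rcases eq_or_ne x 0 with rfl | hx
  · simp
  have h1 := hasSum_coth x hx
  obtain ⟨f, hf⟩ : ∃ f : ℕ → ℝ, ∀ n, f n =
      2 * (2 * (2 * x) / ((2 * x) ^ 2 + π ^ 2 * ((n : ℝ) + 1) ^ 2)) := ⟨_, fun _ ↦ rfl⟩
  have h2 : HasSum f (2 * (cosh (2 * x) / sinh (2 * x) - 1 / (2 * x))) :=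
    ((hasSum_coth (2 * x) (mul_ne_zero two_ne_zero hx)).mul_left 2).congr_fun hf
  have hodd : HasSum (fun n ↦ f (2 * n + 1)) (cosh x / sinh x - 1 / x) := by
    refine h1.congr_fun fun n ↦ ?_
    have : x ^ 2 + π ^ 2 * ((n : ℝ) + 1) ^ 2 ≠ 0 := by positivity
    rw [hf]
    push_cast
    rw [show (2 * x) ^ 2 + π ^ 2 * (2 * (n : ℝ) + 1 + 1) ^ 2 =
      4 * (x ^ 2 + π ^ 2 * ((n : ℝ) + 1) ^ 2) by ring]
    field_simp
    norm_num
  have hinj : Function.Injective fun n : ℕ ↦ 2 * n := mul_right_injective₀ two_ne_zero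
  obtain ⟨s, heven⟩ : Summable fun n ↦ f (2 * n) := h2.summable.comp_injective hinj
  have hs : s = tanh x := by
    rw [eq_sub_of_add_eq ((heven.even_add_odd hodd).unique h2), Real.sinh_two_mul,
      Real.cosh_two_mul, Real.tanh_eq_sinh_div_cosh]
    have := Real.sinh_ne_zero.2 hx
    have := (Real.cosh_pos x).ne'
    field_simp
    ring
  rw [← hs]
  refine heven.congr_fun fun n ↦ ?_
  have : x ^ 2 + π ^ 2 * (2 * (n : ℝ) + 1) ^ 2 / 4 ≠ 0 := by positivity
  rw [hf]
  push_cast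
  rw [show (2 * x) ^ 2 + π ^ 2 * (2 * (n : ℝ) + 1) ^ 2 =
    4 * (x ^ 2 + π ^ 2 * (2 * (n : ℝ) + 1) ^ 2 / 4) by ring]
  field_simp
  norm_num

theorem hasDerivAt_tanh (x : ℝ) : HasDerivAt tanh (1 - tanh x ^ 2) x := by
  have h := (Real.hasDerivAt_sinh x).div (Real.hasDerivAt_cosh x) (Real.cosh_pos x).ne'
  convert! h using 1
  · ext y; exact Real.tanh_eq_sinh_div_cosh y
  · have := (Real.cosh_pos x).ne'
    rw [Real.tanh_eq_sinh_div_cosh]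
    field_simp

theorem summable_inv_odd_sq :
    Summable fun n : ℕ ↦ 2 / (π ^ 2 * (2 * n + 1) ^ 2 / 4) := by
  have h := ((Real.summable_one_div_nat_pow.2 one_lt_two).comp_injective
    (i := fun n : ℕ ↦ 2 * n + 1) (fun a b h ↦ by simpa using h)).mul_left (8 / π ^ 2)
  refine h.congr fun n ↦ ?_
  simp only [Function.comp_apply]
  push_cast
  field_simp
  norm_num

theorem hasSum_deriv_tanh (x : ℝ) :
    HasSum (fun n : ℕ ↦ 2 / (x ^ 2 + π ^ 2 * (2 * n + 1) ^ 2 / 4)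
      - 4 * x ^ 2 / (x ^ 2 + π ^ 2 * (2 * n + 1) ^ 2 / 4) ^ 2) (1 - tanh x ^ 2) := by
  have hbound (n : ℕ) (y : ℝ) : ‖2 / (y ^ 2 + π ^ 2 * (2 * n + 1) ^ 2 / 4)
      - 4 * y ^ 2 / (y ^ 2 + π ^ 2 * (2 * n + 1) ^ 2 / 4) ^ 2‖ ≤
      2 / (π ^ 2 * (2 * n + 1) ^ 2 / 4) := by
    have ha : 0 < π ^ 2 * (2 * n + 1) ^ 2 / 4 := by positivity
    generalize π ^ 2 * (2 * n + 1) ^ 2 / 4 = a at ha ⊢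
    have hya : 0 < y ^ 2 + a := by positivity
    have e : 2 / (y ^ 2 + a) - 4 * y ^ 2 / (y ^ 2 + a) ^ 2 =
        2 / (y ^ 2 + a) * ((a - y ^ 2) / (y ^ 2 + a)) := by
      field_simp
      ring
    have h1 : |(a - y ^ 2) / (y ^ 2 + a)| ≤ 1 := by
      rw [abs_div, abs_of_pos hya, div_le_one hya, abs_le]
      constructor <;> nlinarith [sq_nonneg y]
    rw [e, norm_mul, Real.norm_of_nonneg (by positivity : 0 ≤ 2 / (y ^ 2 + a)), Real.norm_eq_abs]
    calc _ ≤ 2 / (y ^ 2 + a) * 1 := by gcongr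
      _ ≤ 2 / a := by
        rw [mul_one]
        gcongr
        nlinarith [sq_nonneg y]
  have hderiv := hasDerivAt_tsum summable_inv_odd_sq (𝕜 := ℝ) (y₀ := 0)
    (g := fun (n : ℕ) y ↦ 2 * y / (y ^ 2 + π ^ 2 * (2 * n + 1) ^ 2 / 4))
    (fun n y ↦ by
      have hya : y ^ 2 + π ^ 2 * (2 * n + 1) ^ 2 / 4 ≠ 0 := by positivity
      convert! ((hasDerivAt_id y).const_mul 2).div
        ((hasDerivAt_pow 2 y).add_const (π ^ 2 * (2 * n + 1) ^ 2 / 4)) hya using 1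
      generalize y ^ 2 + π ^ 2 * (2 * n + 1) ^ 2 / 4 = b at hya ⊢
      simp
      field_simp
      ring)
    hbound (hasSum_tanh 0).summable x
  rw [funext fun y ↦ (hasSum_tanh y).tsum_eq] at hderiv
  rw [(hasDerivAt_tanh x).unique hderiv]
  exact (Summable.of_norm_bounded summable_inv_odd_sq fun n ↦ hbound n x).hasSum

theorem stmt_9 (lam : ℝ) (hlam : 0 < lam) :
    Real.tanh (Real.sqrt lam) ^ 2 / lam =
      ∑' n : ℕ, (2 / ((π ^ 2 * (2 * n + 1) ^ 2 / 4) * (lam + π ^ 2 * (2 * n + 1) ^ 2 / 4))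
        + 4 / (lam + π ^ 2 * (2 * n + 1) ^ 2 / 4) ^ 2) := by
  have h := ((hasSum_deriv_tanh 0).sub (hasSum_deriv_tanh (√lam))).div_const lam
  rw [Real.sq_sqrt hlam.le] at h
  rw [show tanh √lam ^ 2 / lam = (1 - tanh 0 ^ 2 - (1 - tanh √lam ^ 2)) / lam by simp,
    ← h.tsum_eq]
  congr 1 with n
  have ha : 0 < π ^ 2 * (2 * n + 1) ^ 2 / 4 := by positivity
  generalize π ^ 2 * (2 * (n : ℝ) + 1) ^ 2 / 4 = a at ha ⊢
  field_simp
  ring
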